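/- (Distributional transform, Rüschendorf.) Let X be a real-valued random variable with cumulative distribution function F, let F(x−) = P(X < x) denote its left limit, and let V be uniformly distributed on (0,1) and independent of X. Define U := F(X−) + V·(F(X) − F(X−)). Then U is uniformly distributed on (0,1). -/

import Mathlib

open MeasureTheory ProbabilityTheory

/-- A probability measure on `ℝ` is uniform on `(0,1)` as soon as the masses of `Iio u` and `Iic u`
enclose `u` for every `u ∈ (0,1)`. -/
lemma eq_restrict_Ioo_of_measure_Iio_le_of_le_measure_Iic
    (ν : Measure ℝ) [IsProbabilityMeasure ν]
    (hlt : ∀ u ∈ Set.Ioo (0 : ℝ) 1, ν (Set.Iio u) ≤ ENNReal.ofReal u)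
    (hle : ∀ u ∈ Set.Ioo (0 : ℝ) 1, ENNReal.ofReal u ≤ ν (Set.Iic u)) :
    ν = volume.restrict (Set.Ioo (0 : ℝ) 1) := by
  have hupper : ∀ u : ℝ, 0 ≤ u → u < 1 → ν.real (Set.Iic u) ≤ u := by
    intro u hu0 hu1
    refine le_of_forall_gt_imp_ge_of_dense fun w hw => ?_
    have hm : min w ((u + 1) / 2) ∈ Set.Ioo (0 : ℝ) 1 :=
      ⟨lt_min (by linarith) (by linarith), (min_le_right _ _).trans_lt (by linarith)⟩
    have hum : u < min w ((u + 1) / 2) := lt_min hw (by linarith)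
    refine le_trans ?_ (min_le_left w ((u + 1) / 2))
    refine ENNReal.toReal_le_of_le_ofReal hm.1.le ?_
    exact (measure_mono (Set.Iic_subset_Iio.2 hum)).trans (hlt _ hm)
  have hlower : ∀ u ∈ Set.Ioo (0 : ℝ) 1, u ≤ ν.real (Set.Iic u) := fun u hu =>
    (ENNReal.ofReal_le_iff_le_toReal (measure_ne_top _ _)).1 (hle u hu)
  refine Measure.ext_of_Iic _ _ fun u => ?_
  rw [Measure.restrict_apply measurableSet_Iic, ← ofReal_measureReal (μ := ν)]
  rcases le_or_gt u 0 with hu0 | hu0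
  · have hempty : Set.Iic u ∩ Set.Ioo (0 : ℝ) 1 = ∅ := by
      ext x
      simp only [Set.mem_inter_iff, Set.mem_Iic, Set.mem_Ioo, Set.mem_empty_iff_false, iff_false]
      rintro ⟨h, h', -⟩
      linarith
    rw [hempty, measure_empty, ENNReal.ofReal_eq_zero]
    exact (measureReal_mono (Set.Iic_subset_Iic.2 hu0)).trans (hupper 0 le_rfl one_pos)
  rcases lt_or_ge u 1 with hu1 | hu1
  · have hIoc : Set.Iic u ∩ Set.Ioo (0 : ℝ) 1 = Set.Ioc 0 u := by
      ext x
      simp only [Set.mem_inter_iff, Set.mem_Iic, Set.mem_Ioo, Set.mem_Ioc]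
      exact ⟨fun h => ⟨h.2.1, h.1⟩, fun h => ⟨h.2, h.1, h.2.trans_lt hu1⟩⟩
    rw [hIoc, Real.volume_Ioc, sub_zero,
      le_antisymm (hupper u hu0.le hu1) (hlower u ⟨hu0, hu1⟩)]
  · have hIoo : Set.Iic u ∩ Set.Ioo (0 : ℝ) 1 = Set.Ioo 0 1 :=
      Set.inter_eq_right.2 fun x hx => hx.2.le.trans hu1
    rw [hIoo, Real.volume_Ioo, sub_zero]
    congr 1
    refine le_antisymm measureReal_le_one (le_of_forall_lt_imp_le_of_dense fun w hw => ?_)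
    have hm : max w (1 / 2) ∈ Set.Ioo (0 : ℝ) 1 :=
      ⟨lt_max_of_lt_right (by norm_num), max_lt hw (by norm_num)⟩
    exact (le_max_left _ _).trans ((hlower _ hm).trans
      (measureReal_mono (Set.Iic_subset_Iic.2 (hm.2.le.trans hu1))))

lemma exists_quantile (μ : Measure ℝ) [IsProbabilityMeasure μ] {u : ℝ}
    (hu : u ∈ Set.Ioo (0 : ℝ) 1) :
    ∃ q, (∀ x < q, cdf μ x < u) ∧ u ≤ cdf μ q ∧ μ.real (Set.Iio q) ≤ u := by
  set S : Set ℝ := {x | u ≤ cdf μ x}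
  have hne : S.Nonempty :=
    (((tendsto_cdf_atTop μ).eventually_const_lt hu.2).exists).imp fun _ h => h.le
  obtain ⟨b, hb⟩ := ((tendsto_cdf_atBot μ).eventually_lt_const hu.1).exists
  have hbdd : BddBelow S := ⟨b, fun x hx => by
    by_contra! h
    exact absurd (le_trans hx (monotone_cdf μ h.le)) hb.not_ge⟩
  have hbelow : ∀ x < sInf S, cdf μ x < u := fun x hx => by
    by_contra! h
    exact hx.not_ge (csInf_le hbdd h)
  refine ⟨sInf S, hbelow, ?_, ?_⟩
  · have hright : Filter.Tendsto (cdf μ) (nhdsWithin (sInf S) (Set.Ioi (sInf S)))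
        (nhds (cdf μ (sInf S))) :=
      ((cdf μ).right_continuous (sInf S)).mono Set.Ioi_subset_Ici_self
    refine ge_of_tendsto hright (eventually_mem_nhdsWithin.mono fun x hx => ?_)
    obtain ⟨y, hy, hyx⟩ := exists_lt_of_csInf_lt hne hx
    exact le_trans hy (monotone_cdf μ hyx.le)
  · refine ENNReal.toReal_le_of_le_ofReal hu.1.le ?_
    have h := (cdf μ).measure_Iio (tendsto_cdf_atBot μ) (sInf S)
    rw [measure_cdf, sub_zero] at h
    rw [h]
    refine ENNReal.ofReal_le_ofReal ?_
    exact le_of_tendsto ((monotone_cdf μ).tendsto_leftLim _)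
      (eventually_mem_nhdsWithin.mono fun x hx => (hbelow x hx).le)

lemma ofReal_mul_volume_restrict_Ioo_mul_lt_le (c : ℝ) {p : ℝ} (hp : 0 ≤ p) :
    ENNReal.ofReal p * volume.restrict (Set.Ioo (0 : ℝ) 1) {v | v * p < c} ≤ ENNReal.ofReal c := by
  rcases hp.eq_or_lt with rfl | hp
  · simp
  have hset : {v : ℝ | v * p < c} = Set.Iio (c / p) := by
    ext v
    simp [lt_div_iff₀ hp]
  have hsub : Set.Iio (c / p) ∩ Set.Ioo (0 : ℝ) 1 ⊆ Set.Ioo 0 (c / p) := fun v hv => ⟨hv.2.1, hv.1⟩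
  rw [hset, Measure.restrict_apply measurableSet_Iio]
  calc ENNReal.ofReal p * volume (Set.Iio (c / p) ∩ Set.Ioo (0 : ℝ) 1)
      ≤ ENNReal.ofReal p * volume (Set.Ioo 0 (c / p)) := by gcongr
    _ = ENNReal.ofReal c := by
      rw [Real.volume_Ioo, sub_zero, ← ENNReal.ofReal_mul hp.le, mul_div_cancel₀ _ hp.ne']

lemma ofReal_le_mul_volume_restrict_Ioo_mul_le {c p : ℝ} (hc : 0 ≤ c) (hcp : c ≤ p) :
    ENNReal.ofReal c ≤
      ENNReal.ofReal p * volume.restrict (Set.Ioo (0 : ℝ) 1) {v | v * p ≤ c} := by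
  rcases (hc.trans hcp).eq_or_lt with rfl | hp
  · simp [hcp]
  have hset : {v : ℝ | v * p ≤ c} = Set.Iic (c / p) := by
    ext v
    simp [le_div_iff₀ hp]
  have hsub : Set.Ioo 0 (c / p) ⊆ Set.Iic (c / p) ∩ Set.Ioo (0 : ℝ) 1 := fun v hv =>
    ⟨hv.2.le, hv.1, hv.2.trans_le ((div_le_one hp).2 hcp)⟩
  rw [hset, Measure.restrict_apply measurableSet_Iic]
  calc ENNReal.ofReal c = ENNReal.ofReal p * volume (Set.Ioo 0 (c / p)) := by
        rw [Real.volume_Ioo, sub_zero, ← ENNReal.ofReal_mul hp.le, mul_div_cancel₀ _ hp.ne']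
    _ ≤ ENNReal.ofReal p * volume (Set.Iic (c / p) ∩ Set.Ioo (0 : ℝ) 1) := by gcongr

lemma measureReal_Iio_add_singleton (μ : Measure ℝ) [IsProbabilityMeasure μ] (x : ℝ) :
    μ.real (Set.Iio x) + μ.real {x} = cdf μ x := by
  rw [cdf_eq_real, ← measureReal_union (by simp) (measurableSet_singleton x), Set.Iio_union_right]

/-- (Distributional transform, Rüschendorf.) Let `X` be a real random variable with CDF `F`,
`F(x−) = P(X < x)` its left limit, and let `V ~ Uniform(0,1)` be independent of `X`.
Then `U := F(X−) + V·(F(X) − F(X−))` is uniformly distributed on `(0,1)`.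
No continuity assumption is made on `F`. -/
theorem distributional_transform_uniform
    {Ω : Type*} [MeasurableSpace Ω] (P : Measure Ω) [IsProbabilityMeasure P]
    (X V : Ω → ℝ) (hX : Measurable X) (hV : Measurable V)
    (hVlaw : P.map V = volume.restrict (Set.Ioo (0 : ℝ) 1))
    (hindep : IndepFun X V P) :
    P.map (fun ω =>
        ((P.map X) (Set.Iio (X ω))).toReal +
          V ω * (cdf (P.map X) (X ω) - ((P.map X) (Set.Iio (X ω))).toReal)) =
      volume.restrict (Set.Ioo (0 : ℝ) 1) := by
  have hμ : IsProbabilityMeasure (P.map X) := Measure.isProbabilityMeasure_map hX.aemeasurable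
  set μ := P.map X with hμdef
  change P.map (fun ω => μ.real (Set.Iio (X ω)) +
    V ω * (cdf μ (X ω) - μ.real (Set.Iio (X ω)))) = _
  have hG : Measurable fun x => μ.real (Set.Iio x) :=
    Monotone.measurable fun x y hxy => measureReal_mono (Set.Iio_subset_Iio hxy)
  have hF : Measurable (cdf μ) := (monotone_cdf μ).measurable
  set U : Ω → ℝ := fun ω => μ.real (Set.Iio (X ω)) +
    V ω * (cdf μ (X ω) - μ.real (Set.Iio (X ω))) with hU
  have hUm : Measurable U :=
    (hG.comp hX).add (hV.mul ((hF.comp hX).sub (hG.comp hX)))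
  have hν : IsProbabilityMeasure (P.map U) := Measure.isProbabilityMeasure_map hUm.aemeasurable
  have hV01 : ∀ᵐ ω ∂P, V ω ∈ Set.Ioo (0 : ℝ) 1 := by
    refine ae_of_ae_map hV.aemeasurable ?_
    rw [hVlaw]
    exact ae_restrict_mem measurableSet_Ioo
  have hjump (x : ℝ) : cdf μ x - μ.real (Set.Iio x) = μ.real {x} := by
    rw [← measureReal_Iio_add_singleton, add_sub_cancel_left]
  have hatom (q : ℝ) {B : Set ℝ} (hB : MeasurableSet B) :
      P (X ⁻¹' {q} ∩ V ⁻¹' B) =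
        ENNReal.ofReal (μ.real {q}) * volume.restrict (Set.Ioo (0 : ℝ) 1) B := by
    rw [hindep.measure_inter_preimage_eq_mul _ _ (measurableSet_singleton q) hB,
      ofReal_measureReal, ← hVlaw, Measure.map_apply hV hB, hμdef,
      Measure.map_apply hX (measurableSet_singleton q)]
  have hbelow (q : ℝ) : P (X ⁻¹' Set.Iio q) = ENNReal.ofReal (μ.real (Set.Iio q)) := by
    rw [ofReal_measureReal, hμdef, Measure.map_apply hX measurableSet_Iio]
  refine eq_restrict_Ioo_of_measure_Iio_le_of_le_measure_Iic _ (fun u hu => ?_) fun u hu => ?_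
  · obtain ⟨q, -, hq, hGq⟩ := exists_quantile μ hu
    rw [Measure.map_apply hUm measurableSet_Iio]
    have hsub : U ⁻¹' Set.Iio u ≤ᵐ[P] (X ⁻¹' Set.Iio q ∪
        (X ⁻¹' {q} ∩ V ⁻¹' {v | v * μ.real {q} < u - μ.real (Set.Iio q)}) : Set Ω) := by
      filter_upwards [hV01] with ω hω hUω
      change U ω < u at hUω
      simp only [hU, hjump] at hUω
      rcases lt_trichotomy (X ω) q with h | h | h
      · exact Or.inl h
      · refine Or.inr ⟨h, ?_⟩
        rw [h] at hUω
        change V ω * μ.real {q} < u - μ.real (Set.Iio q)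
        linarith
      · have hle : cdf μ q ≤ μ.real (Set.Iio (X ω)) := by
          rw [cdf_eq_real]
          exact measureReal_mono (Set.Iic_subset_Iio.2 h)
        have : 0 ≤ V ω * μ.real {X ω} := mul_nonneg hω.1.le measureReal_nonneg
        linarith
    calc P (U ⁻¹' Set.Iio u) ≤ _ := measure_mono_ae hsub
      _ ≤ _ := measure_union_le _ _
      _ ≤ ENNReal.ofReal (μ.real (Set.Iio q)) + ENNReal.ofReal (u - μ.real (Set.Iio q)) := by
        rw [hbelow, hatom q (measurableSet_lt (by fun_prop) (by fun_prop))]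
        gcongr
        exact ofReal_mul_volume_restrict_Ioo_mul_lt_le _ measureReal_nonneg
      _ = ENNReal.ofReal u := by
        rw [← ENNReal.ofReal_add measureReal_nonneg (sub_nonneg.2 hGq), add_sub_cancel]
  · obtain ⟨q, hlt, hq, hGq⟩ := exists_quantile μ hu
    rw [Measure.map_apply hUm measurableSet_Iic]
    have hB : MeasurableSet {v : ℝ | v * μ.real {q} ≤ u - μ.real (Set.Iio q)} :=
      measurableSet_le (by fun_prop) (by fun_prop)
    have hsub : (X ⁻¹' Set.Iio q ∪
        (X ⁻¹' {q} ∩ V ⁻¹' {v | v * μ.real {q} ≤ u - μ.real (Set.Iio q)}) : Set Ω)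
        ≤ᵐ[P] U ⁻¹' Set.Iic u := by
      filter_upwards [hV01] with ω hω hmem
      change U ω ≤ u
      simp only [hU, hjump]
      rcases hmem with h | ⟨h, h'⟩
      · have hFx := hlt _ h
        rw [← measureReal_Iio_add_singleton] at hFx
        have : V ω * μ.real {X ω} ≤ μ.real {X ω} :=
          mul_le_of_le_one_left measureReal_nonneg hω.2.le
        linarith
      · change X ω = q at h
        change V ω * μ.real {q} ≤ u - μ.real (Set.Iio q) at h'
        rw [h]
        linarith
    have hdisj : Disjoint (X ⁻¹' Set.Iio q)
        (X ⁻¹' {q} ∩ V ⁻¹' {v | v * μ.real {q} ≤ u - μ.real (Set.Iio q)}) :=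
      Disjoint.mono_right Set.inter_subset_left (Disjoint.preimage X (by simp))
    calc ENNReal.ofReal u
        = ENNReal.ofReal (μ.real (Set.Iio q)) + ENNReal.ofReal (u - μ.real (Set.Iio q)) := by
          rw [← ENNReal.ofReal_add measureReal_nonneg (sub_nonneg.2 hGq), add_sub_cancel]
      _ ≤ P (X ⁻¹' Set.Iio q) +
          P (X ⁻¹' {q} ∩ V ⁻¹' {v | v * μ.real {q} ≤ u - μ.real (Set.Iio q)}) := by
        rw [hbelow, hatom q hB]
        gcongr
        refine ofReal_le_mul_volume_restrict_Ioo_mul_le (sub_nonneg.2 hGq) ?_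
        rw [← hjump]
        linarith
      _ = _ := (measure_union hdisj ((hX (measurableSet_singleton q)).inter (hV hB))).symm
      _ ≤ P (U ⁻¹' Set.Iic u) := measure_mono_ae hsub
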